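/- The lattices ⟨2⟩ ⊕ E₈ ⊕ E₈ and U ⊕ E₈ ⊕ E₇ are isometric: there exists a matrix P ∈ GL₁₇(ℤ) (i.e., an integer 17×17 matrix with determinant ±1) such that Pᵀ G₁ P = G₂, where G₁ is the block-diagonal Gram matrix of ⟨2⟩ ⊕ E₈ ⊕ E₈ and G₂ is the block-diagonal Gram matrix of U ⊕ E₈ ⊕ E₇. -/

import Mathlib

open Matrix

noncomputable section

/-- The Gram matrix of the negative definite root lattice `E₈` (the negative of the Cartan
matrix of `E₈`, with nodes `0–1–2–3–4–5–6` in a chain and node `7` attached to node `2`). -/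
def E8 : Matrix (Fin 8) (Fin 8) ℤ :=
  -(!![2,-1, 0, 0, 0, 0, 0, 0;
      -1, 2,-1, 0, 0, 0, 0, 0;
       0,-1, 2,-1, 0, 0, 0,-1;
       0, 0,-1, 2,-1, 0, 0, 0;
       0, 0, 0,-1, 2,-1, 0, 0;
       0, 0, 0, 0,-1, 2,-1, 0;
       0, 0, 0, 0, 0,-1, 2, 0;
       0, 0,-1, 0, 0, 0, 0, 2])

/-- The Gram matrix of the negative definite root lattice `E₇` (the negative of the Cartan
matrix of `E₇`, with nodes `0–1–2–3–4–5` in a chain and node `6` attached to node `2`). -/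
def E7 : Matrix (Fin 7) (Fin 7) ℤ :=
  -(!![2,-1, 0, 0, 0, 0, 0;
      -1, 2,-1, 0, 0, 0, 0;
       0,-1, 2,-1, 0, 0,-1;
       0, 0,-1, 2,-1, 0, 0;
       0, 0, 0,-1, 2,-1, 0;
       0, 0, 0, 0,-1, 2, 0;
       0, 0,-1, 0, 0, 0, 2])

/-- The Gram matrix of the hyperbolic plane `U`. -/
def U : Matrix (Fin 2) (Fin 2) ℤ := !![0, 1; 1, 0]

/-- The reindexing equivalence `Fin 1 ⊕ (Fin 8 ⊕ Fin 8) ≃ Fin 17`. -/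
def e₁ : (Fin 1 ⊕ (Fin 8 ⊕ Fin 8)) ≃ Fin 17 :=
  ((Equiv.refl (Fin 1)).sumCongr finSumFinEquiv).trans
    (finSumFinEquiv.trans (finCongr (by norm_num)))

/-- The reindexing equivalence `Fin 2 ⊕ (Fin 8 ⊕ Fin 7) ≃ Fin 17`. -/
def e₂ : (Fin 2 ⊕ (Fin 8 ⊕ Fin 7)) ≃ Fin 17 :=
  ((Equiv.refl (Fin 2)).sumCongr finSumFinEquiv).trans
    (finSumFinEquiv.trans (finCongr (by norm_num)))

/-- The block-diagonal Gram matrix of `⟨2⟩ ⊕ E₈ ⊕ E₈`. -/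
def G₁ : Matrix (Fin 17) (Fin 17) ℤ :=
  Matrix.reindex e₁ e₁ (Matrix.fromBlocks !![2] 0 0 (Matrix.fromBlocks E8 0 0 E8))

/-- The block-diagonal Gram matrix of `U ⊕ E₈ ⊕ E₇`. -/
def G₂ : Matrix (Fin 17) (Fin 17) ℤ :=
  Matrix.reindex e₂ e₂ (Matrix.fromBlocks U 0 0 (Matrix.fromBlocks E8 0 0 E7))

/-- The matrix of an isometry from `U ⊕ E₈ ⊕ E₇` to `⟨2⟩ ⊕ E₈ ⊕ E₈`. Write `h` for the generator
of `⟨2⟩`, `αᵢ` for the simple roots of the second `E₈` and `θ` for its highest root. Then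
`f = h - θ` is isotropic with `f ⬝ α₆ = 1`, so `f` and `α₆ + f` span a copy of `U`. Its orthogonal
complement is the sum of the first `E₈` and the copy of `E₇` with simple roots
`α₀, α₁, α₂, α₃, α₄, α₅ - f, α₇`. -/
def isometryMatrix : Matrix (Fin 17) (Fin 17) ℤ :=
  !![ 1,  1,  0,  0,  0,  0,  0,  0,  0,  0,  0,  0,  0,  0,  0, -1,  0;
      0,  0,  1,  0,  0,  0,  0,  0,  0,  0,  0,  0,  0,  0,  0,  0,  0;
      0,  0,  0,  1,  0,  0,  0,  0,  0,  0,  0,  0,  0,  0,  0,  0,  0;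
      0,  0,  0,  0,  1,  0,  0,  0,  0,  0,  0,  0,  0,  0,  0,  0,  0;
      0,  0,  0,  0,  0,  1,  0,  0,  0,  0,  0,  0,  0,  0,  0,  0,  0;
      0,  0,  0,  0,  0,  0,  1,  0,  0,  0,  0,  0,  0,  0,  0,  0,  0;
      0,  0,  0,  0,  0,  0,  0,  1,  0,  0,  0,  0,  0,  0,  0,  0,  0;
      0,  0,  0,  0,  0,  0,  0,  0,  1,  0,  0,  0,  0,  0,  0,  0,  0;
      0,  0,  0,  0,  0,  0,  0,  0,  0,  1,  0,  0,  0,  0,  0,  0,  0;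
     -2, -2,  0,  0,  0,  0,  0,  0,  0,  0,  1,  0,  0,  0,  0,  2,  0;
     -4, -4,  0,  0,  0,  0,  0,  0,  0,  0,  0,  1,  0,  0,  0,  4,  0;
     -6, -6,  0,  0,  0,  0,  0,  0,  0,  0,  0,  0,  1,  0,  0,  6,  0;
     -5, -5,  0,  0,  0,  0,  0,  0,  0,  0,  0,  0,  0,  1,  0,  5,  0;
     -4, -4,  0,  0,  0,  0,  0,  0,  0,  0,  0,  0,  0,  0,  1,  4,  0;
     -3, -3,  0,  0,  0,  0,  0,  0,  0,  0,  0,  0,  0,  0,  0,  4,  0;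
     -2, -1,  0,  0,  0,  0,  0,  0,  0,  0,  0,  0,  0,  0,  0,  2,  0;
     -3, -3,  0,  0,  0,  0,  0,  0,  0,  0,  0,  0,  0,  0,  0,  3,  1]

/-- The inverse of `isometryMatrix`. -/
def isometryMatrixInv : Matrix (Fin 17) (Fin 17) ℤ :=
  !![ 2,  0,  0,  0,  0,  0,  0,  0,  0,  0,  0,  0,  0,  0,  1, -1,  0;
      2,  0,  0,  0,  0,  0,  0,  0,  0,  0,  0,  0,  0,  0,  0,  1,  0;
      0,  1,  0,  0,  0,  0,  0,  0,  0,  0,  0,  0,  0,  0,  0,  0,  0;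
      0,  0,  1,  0,  0,  0,  0,  0,  0,  0,  0,  0,  0,  0,  0,  0,  0;
      0,  0,  0,  1,  0,  0,  0,  0,  0,  0,  0,  0,  0,  0,  0,  0,  0;
      0,  0,  0,  0,  1,  0,  0,  0,  0,  0,  0,  0,  0,  0,  0,  0,  0;
      0,  0,  0,  0,  0,  1,  0,  0,  0,  0,  0,  0,  0,  0,  0,  0,  0;
      0,  0,  0,  0,  0,  0,  1,  0,  0,  0,  0,  0,  0,  0,  0,  0,  0;
      0,  0,  0,  0,  0,  0,  0,  1,  0,  0,  0,  0,  0,  0,  0,  0,  0;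
      0,  0,  0,  0,  0,  0,  0,  0,  1,  0,  0,  0,  0,  0,  0,  0,  0;
      2,  0,  0,  0,  0,  0,  0,  0,  0,  1,  0,  0,  0,  0,  0,  0,  0;
      4,  0,  0,  0,  0,  0,  0,  0,  0,  0,  1,  0,  0,  0,  0,  0,  0;
      6,  0,  0,  0,  0,  0,  0,  0,  0,  0,  0,  1,  0,  0,  0,  0,  0;
      5,  0,  0,  0,  0,  0,  0,  0,  0,  0,  0,  0,  1,  0,  0,  0,  0;
      4,  0,  0,  0,  0,  0,  0,  0,  0,  0,  0,  0,  0,  1,  0,  0,  0;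
      3,  0,  0,  0,  0,  0,  0,  0,  0,  0,  0,  0,  0,  0,  1,  0,  0;
      3,  0,  0,  0,  0,  0,  0,  0,  0,  0,  0,  0,  0,  0,  0,  0,  1]

theorem isometryMatrix_mul_inv : isometryMatrix * isometryMatrixInv = 1 := by
  decide +kernel

theorem isometryMatrix_transpose_mul_mul : isometryMatrixᵀ * G₁ * isometryMatrix = G₂ := by
  decide +kernel

theorem det_isometryMatrix : isometryMatrix.det = 1 ∨ isometryMatrix.det = -1 :=
  Int.isUnit_iff.mp <| isUnit_det_of_right_inverse isometryMatrix_mul_inv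

/-- The lattices `⟨2⟩ ⊕ E₈ ⊕ E₈` and `U ⊕ E₈ ⊕ E₇` are isometric: there is an integer
matrix `P` of determinant `±1` with `Pᵀ G₁ P = G₂`. -/
theorem latticeIsometry_two_E8_E8 :
    ∃ P : Matrix (Fin 17) (Fin 17) ℤ,
      (P.det = 1 ∨ P.det = -1) ∧ Pᵀ * G₁ * P = G₂ :=
  ⟨isometryMatrix, det_isometryMatrix, isometryMatrix_transpose_mul_mul⟩
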